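/- arXiv:2510.23791 — 4 statements merged into one kernel-verified Lean document; each statement's English description precedes it below -/
import Mathlib

section
/- Let n ≥ 1 be an integer, p ≥ 2 a real number, ε ∈ [0,1], and let x ∈ 𝒴(ε,p). Then the squared coefficient of variation of x satisfies (CV(x))² ≤ B_p(ε), where B_p(ε) = (D_p + 1)²/(1 + ε·D_p)² − 1. -/
open Finset

/-- Comparison of the `ℓ²` and `ℓᵖ` norms of a nonnegative vector for `2 ≤ p`. -/
theorem card_mul_sum_sq_le (n : ℕ) (hn : 1 ≤ n) (p : ℝ) (hp : 2 ≤ p)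
    (x : Fin n → ℝ) (hx : ∀ i, 0 ≤ x i) :
    (n : ℝ) * ∑ i, x i ^ 2 ≤ ((n : ℝ) ^ (1 - 1/p) * (∑ i, x i ^ p) ^ (1/p)) ^ 2 := by
  have hp0 : 0 < p := by linarith
  have hn0 : (0 : ℝ) < n := by exact_mod_cast hn
  have hS : 0 ≤ ∑ i, x i ^ p := sum_nonneg fun i _ => Real.rpow_nonneg (hx i) p
  have hQ : 0 ≤ ∑ i, x i ^ 2 := sum_nonneg fun i _ => sq_nonneg (x i)
  have key := Real.rpow_sum_le_const_mul_sum_rpow_of_nonneg (s := univ)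
    (f := fun i => x i ^ 2) (p := p / 2) (by linarith) (fun i _ => sq_nonneg (x i))
  have hpow : ∀ i, (x i ^ 2) ^ (p / 2) = x i ^ p := fun i => by
    rw [← Real.rpow_natCast, ← Real.rpow_mul (hx i)]
    congr 1
    push_cast
    ring
  simp only [hpow, card_univ, Fintype.card_fin] at key
  have h := Real.rpow_le_rpow (Real.rpow_nonneg hQ _) key (show 0 ≤ 2 / p by positivity)
  rw [← Real.rpow_mul hQ, show p / 2 * (2 / p) = 1 by field_simp, Real.rpow_one,
    Real.mul_rpow (Real.rpow_nonneg hn0.le _) hS, ← Real.rpow_mul hn0.le] at h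
  calc (n : ℝ) * ∑ i, x i ^ 2
      ≤ n * ((n : ℝ) ^ ((p / 2 - 1) * (2 / p)) * (∑ i, x i ^ p) ^ (2 / p)) := by gcongr
    _ = (n : ℝ) ^ (1 + (p / 2 - 1) * (2 / p)) * (∑ i, x i ^ p) ^ (2 / p) := by
        rw [Real.rpow_add hn0, Real.rpow_one, mul_assoc]
    _ = ((n : ℝ) ^ (1 - 1/p) * (∑ i, x i ^ p) ^ (1/p)) ^ 2 := by
        rw [mul_pow, ← Real.rpow_mul_natCast hn0.le, ← Real.rpow_mul_natCast hS]
        congr 2 <;> push_cast <;> field_simp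
        ring

/-- The squared coefficient of variation of a vector with coordinate sum one. -/
theorem sq_coeff_variation_eq (n : ℕ) (hn : 1 ≤ n) (x : Fin n → ℝ) (hsum : ∑ i, x i = 1) :
    (Real.sqrt ((1 / (n : ℝ)) * ∑ i, (x i - 1 / (n : ℝ)) ^ 2) / (1 / (n : ℝ))) ^ 2 =
      n * ∑ i, x i ^ 2 - 1 := by
  have hn0 : (0 : ℝ) < n := by exact_mod_cast hn
  have hvar : ∑ i, (x i - 1 / (n : ℝ)) ^ 2 = ∑ i, x i ^ 2 - 1 / n := by
    simp only [sub_sq, sum_add_distrib, sum_sub_distrib, ← sum_mul, ← mul_sum, hsum, sum_const,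
      card_univ, Fintype.card_fin, nsmul_eq_mul]
    field_simp
    ring
  rw [div_pow, Real.sq_sqrt (mul_nonneg (by positivity) (sum_nonneg fun i _ => sq_nonneg _)), hvar]
  field_simp

/-- for `x ∈ 𝒴(ε,p)`, the squared coefficient of variation
`CV(x)² = (√((1/n)∑(xᵢ-μ)²)/μ)²` with `μ = 1/n` is bounded by
`B_p(ε) = (D_p+1)²/(1+ε·D_p)² - 1`. -/
theorem stmt_2 (n : ℕ) (hn : 1 ≤ n) (p : ℝ) (hp : 2 ≤ p)
    (ε : ℝ) (hε : ε ∈ Set.Icc (0:ℝ) 1)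
    (x : Fin n → ℝ) (hx : ∀ i, 0 ≤ x i) (hsum : ∑ i, x i = 1)
    (hfair : (1 + ε * ((n : ℝ) ^ (1 - 1/p) - 1)) * (∑ i, x i ^ p) ^ (1/p) ≤ 1) :
    (Real.sqrt ((1 / (n : ℝ)) * ∑ i, (x i - 1 / (n : ℝ)) ^ 2) / (1 / (n : ℝ))) ^ 2 ≤
      (((n : ℝ) ^ (1 - 1/p) - 1) + 1) ^ 2 / (1 + ε * ((n : ℝ) ^ (1 - 1/p) - 1)) ^ 2 - 1 := by
  have hn1 : (1 : ℝ) ≤ n := by exact_mod_cast hn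
  have hp1 : 1 / p ≤ 1 := by rw [div_le_one (by linarith)]; linarith
  have hD : 1 ≤ (n : ℝ) ^ (1 - 1/p) := Real.one_le_rpow hn1 (by linarith)
  have hpos : 0 < 1 + ε * ((n : ℝ) ^ (1 - 1/p) - 1) := by
    have := mul_nonneg hε.1 (sub_nonneg.2 hD)
    linarith
  have hN : 0 ≤ (∑ i, x i ^ p) ^ (1/p) :=
    Real.rpow_nonneg (sum_nonneg fun i _ => Real.rpow_nonneg (hx i) p) _
  rw [sq_coeff_variation_eq n hn x hsum, sub_add_cancel, ← div_pow]
  refine sub_le_sub_right ((card_mul_sum_sq_le n hn p hp x hx).trans ?_) 1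
  gcongr
  rw [le_div_iff₀ hpos, mul_assoc, mul_comm (_ ^ (1/p))]
  exact mul_le_of_le_one_right (by linarith) hfair
end

section
/- Let n ≥ 2 be an integer and let x ∈ Δₙ be a vector that is neither a standard unit vector e₁, …, eₙ nor the uniform vector (1/n)·e. Then the function F(p) = (1 − ‖x‖_p)/(D_p · ‖x‖_p) is strictly decreasing in p on the interval [2, ∞); that is, for all real 2 ≤ p₁ < p₂, F(p₁) > F(p₂). -/
open Finset

/-- The secant slopes of `t ↦ t ^ l` based at `1` are strictly increasing when `1 < l`. -/
lemma rpow_sub_one_div_lt {a b l : ℝ} (ha : 1 < a) (hab : a < b) (hl : 1 < l) :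
    (a ^ l - 1) / (b ^ l - 1) < (a - 1) / (b - 1) := by
  have h := (strictConvexOn_rpow hl).secant_strict_mono (a := 1) (x := a) (y := b)
    (by simp) (Set.mem_Ici.2 (by linarith)) (Set.mem_Ici.2 (by linarith)) ha.ne'
    (ha.trans hab).ne' hab
  simp only [Real.one_rpow] at h
  have hb : 1 < b ^ l := Real.one_lt_rpow (ha.trans hab) (by linarith)
  rw [div_lt_div_iff₀ (by linarith) (by linarith)] at h ⊢
  linarith

lemma exists_pos_lt_one_of_not_single {ι : Type*} [Fintype ι] [DecidableEq ι] {x : ι → ℝ}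
    (hx : ∀ i, 0 ≤ x i) (hsum : ∑ i, x i = 1)
    (hunit : ∀ i, x ≠ fun j => if j = i then (1 : ℝ) else 0) :
    ∃ i, 0 < x i ∧ x i < 1 := by
  obtain ⟨i, -, hi⟩ : ∃ i ∈ univ, x i ≠ 0 := exists_ne_zero_of_sum_ne_zero (by rw [hsum]; simp)
  have hi0 : 0 < x i := (hx i).lt_of_ne' hi
  refine ⟨i, hi0, ?_⟩
  by_contra! h
  refine hunit i (funext fun j => ?_)
  have hs := add_sum_erase univ x (mem_univ i)
  have hnn : 0 ≤ ∑ j ∈ univ.erase i, x j := sum_nonneg fun j _ => hx j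
  have h0 : ∑ j ∈ univ.erase i, x j = 0 := by linarith
  split_ifs with hj
  · subst hj; linarith
  · exact (sum_eq_zero_iff_of_nonneg fun j _ => hx j).1 h0 j (by simp [hj])

lemma sum_rpow_lt_one {ι : Type*} [Fintype ι] {x : ι → ℝ} (hx : ∀ i, 0 ≤ x i)
    (hsum : ∑ i, x i = 1) (h : ∃ i, 0 < x i ∧ x i < 1) {p : ℝ} (hp : 1 < p) :
    ∑ i, x i ^ p < 1 := by
  rw [← hsum]
  obtain ⟨i, hi0, hi1⟩ := h
  refine sum_lt_sum (fun j hj => ?_) ⟨i, mem_univ i, ?_⟩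
  · exact Real.rpow_le_self_of_le_one (hx j)
      (hsum ▸ single_le_sum (fun k _ => hx k) hj) hp.le
  · simpa using Real.rpow_lt_rpow_of_exponent_gt hi0 hi1 hp

lemma rpow_one_sub_lt_sum_rpow {n : ℕ} (hn : n ≠ 0) {x : Fin n → ℝ} (hx : ∀ i, 0 ≤ x i)
    (hsum : ∑ i, x i = 1) (hunif : x ≠ fun _ => 1 / (n : ℝ)) {p : ℝ} (hp : 1 < p) :
    (n : ℝ) ^ (1 - p) < ∑ i, x i ^ p := by
  have hn0 : (0 : ℝ) < n := by positivity
  have hne : ∃ i j, x i ≠ x j := by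
    by_contra! hc
    refine hunif (funext fun i => ?_)
    have : ∑ j, x j = n * x i := by simp [fun j => hc j i]
    field_simp
    linarith
  obtain ⟨i, j, hij⟩ := hne
  have h := (strictConvexOn_rpow hp).map_sum_lt (t := univ) (w := fun _ : Fin n => 1 / (n : ℝ))
    (p := x) (fun _ _ => by positivity) (by simp [hn0.ne'])
    (fun i _ => hx i) ⟨i, mem_univ i, j, mem_univ j, hij⟩
  simp only [smul_eq_mul, ← mul_sum, hsum, mul_one] at h
  rw [one_div, Real.inv_rpow hn0.le, inv_mul_eq_div, lt_div_iff₀ hn0] at h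
  rw [Real.rpow_sub hn0, Real.rpow_one, div_eq_inv_mul]
  exact h

/-- On the probability simplex the `ℓᵖ` norms satisfy the interpolation inequality with `ℓ¹`. -/
lemma sum_rpow_rpow_le_sum_rpow {ι : Type*} [Fintype ι] {x : ι → ℝ} (hx : ∀ i, 0 ≤ x i)
    (hsum : ∑ i, x i = 1) {p q : ℝ} (hp : 1 < p) (hpq : p ≤ q) :
    (∑ i, x i ^ p) ^ ((q - 1) / (p - 1)) ≤ ∑ i, x i ^ q := by
  have key : ∀ i, ∀ r : ℝ, 1 < r → x i * x i ^ (r - 1) = x i ^ r := fun i r hr => by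
    rw [← Real.rpow_one_add' (hx i) (by linarith)]
    congr 1
    ring
  have h := Real.rpow_arith_mean_le_arith_mean_rpow univ x (fun i => x i ^ (p - 1))
    (fun i _ => hx i) hsum (fun i _ => Real.rpow_nonneg (hx i) _)
    (p := (q - 1) / (p - 1)) ((one_le_div (by linarith)).2 (by linarith))
  have hp' : p - 1 ≠ 0 := by linarith
  simpa only [← Real.rpow_mul (hx _), mul_div_cancel₀ _ hp', key _ p hp,
    key _ q (hp.trans_le hpq)] using h

/-- for `x ∈ Δₙ` that is neither a standard unit vector nor the
uniform vector, `F(p) = (1 - ‖x‖_p)/(D_p · ‖x‖_p)` is strictly decreasing on `[2,∞)`. -/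
theorem stmt_8 (n : ℕ) (hn : 2 ≤ n)
    (x : Fin n → ℝ) (hx : ∀ i, 0 ≤ x i) (hsum : ∑ i, x i = 1)
    (hunit : ∀ i : Fin n, x ≠ fun j => if j = i then (1:ℝ) else 0)
    (hunif : x ≠ fun _ : Fin n => 1 / (n : ℝ))
    (p₁ p₂ : ℝ) (hp₁ : 2 ≤ p₁) (hp₁₂ : p₁ < p₂) :
    (1 - (∑ i, x i ^ p₁) ^ (1/p₁)) /
        (((n : ℝ) ^ (1 - 1/p₁) - 1) * (∑ i, x i ^ p₁) ^ (1/p₁)) >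
      (1 - (∑ i, x i ^ p₂) ^ (1/p₂)) /
        (((n : ℝ) ^ (1 - 1/p₂) - 1) * (∑ i, x i ^ p₂) ^ (1/p₂)) := by
  have hn0 : (0 : ℝ) < n := by positivity
  have hn1 : (1 : ℝ) < n := by exact_mod_cast hn
  have hp₁0 : 0 < p₁ := by linarith
  have hp₂0 : 0 < p₂ := by linarith
  have hS₁1 := sum_rpow_lt_one hx hsum (exists_pos_lt_one_of_not_single hx hsum hunit)
    (show 1 < p₁ by linarith)
  have hS₁n := rpow_one_sub_lt_sum_rpow (by omega) hx hsum hunif (show 1 < p₁ by linarith)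
  have hS₁₂ := sum_rpow_rpow_le_sum_rpow hx hsum (show 1 < p₁ by linarith) hp₁₂.le
  set S₁ := ∑ i, x i ^ p₁
  set S₂ := ∑ i, x i ^ p₂
  have hS₁ : 0 < S₁ := (Real.rpow_pos_of_pos hn0 _).trans hS₁n
  have hS₂ : 0 < S₂ := (Real.rpow_pos_of_pos hS₁ _).trans_le hS₁₂
  have hN₁ : 0 < S₁ ^ (1 / p₁) := Real.rpow_pos_of_pos hS₁ _
  have hN₂ : 0 < S₂ ^ (1 / p₂) := Real.rpow_pos_of_pos hS₂ _
  have hs₁ : 0 < 1 - 1 / p₁ := by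
    rw [sub_pos, div_lt_one hp₁0]; linarith
  have hs : 1 - 1 / p₁ < 1 - 1 / p₂ :=
    sub_lt_sub_left (one_div_lt_one_div_of_lt hp₁0 hp₁₂) 1
  set l := (1 - 1 / p₂) / (1 - 1 / p₁) with hl
  have hl1 : 1 < l := (one_lt_div hs₁).2 hs
  have hB : (n : ℝ) ^ (1 - 1 / p₂) = ((n : ℝ) ^ (1 - 1 / p₁)) ^ l := by
    rw [← Real.rpow_mul hn0.le, hl, mul_div_cancel₀ _ hs₁.ne']
  have hA1 : 1 < (S₁ ^ (1 / p₁))⁻¹ :=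
    (one_lt_inv₀ hN₁).2 (Real.rpow_lt_one hS₁.le hS₁1 (by positivity))
  have hAB : (S₁ ^ (1 / p₁))⁻¹ < (n : ℝ) ^ (1 - 1 / p₁) := by
    have h := Real.rpow_lt_rpow (by positivity) hS₁n (show 0 < 1 / p₁ by positivity)
    have he : (1 - p₁) * (1 / p₁) = -(1 - 1 / p₁) := by field_simp; ring
    rw [← Real.rpow_mul hn0.le, he, Real.rpow_neg hn0.le] at h
    exact inv_lt_of_inv_lt₀ (by positivity) h
  have hA : (S₂ ^ (1 / p₂))⁻¹ ≤ ((S₁ ^ (1 / p₁))⁻¹) ^ l := by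
    rw [Real.inv_rpow hN₁.le, ← Real.rpow_mul hS₁.le]
    refine inv_anti₀ (Real.rpow_pos_of_pos hS₁ _) ?_
    have h := Real.rpow_le_rpow (by positivity) hS₁₂ (show 0 ≤ 1 / p₂ by positivity)
    have hp₁' : p₁ - 1 ≠ 0 := by linarith
    have he : (p₂ - 1) / (p₁ - 1) * (1 / p₂) = 1 / p₁ * l := by
      rw [hl]; field_simp
    rwa [← Real.rpow_mul hS₁.le, he] at h
  have hrw : ∀ N D : ℝ, 0 < N → (1 - N) / (D * N) = (N⁻¹ - 1) / D := fun N D hN => by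
    rw [mul_comm, ← div_div, sub_div, div_self hN.ne', one_div]
  rw [gt_iff_lt, hrw _ _ hN₁, hrw _ _ hN₂, hB]
  have hBl : 1 < ((n : ℝ) ^ (1 - 1 / p₁)) ^ l :=
    Real.one_lt_rpow (hA1.trans hAB) (by linarith)
  refine lt_of_le_of_lt ?_ (rpow_sub_one_div_lt hA1 hAB hl1)
  exact div_le_div_of_nonneg_right (by linarith) (by linarith)
end

section
/- Let n ≥ 1 be an integer, p ≥ 2 a real number, and let x ∈ Δₙ be nonzero with S_p = Σᵢ xᵢ^p and wᵢ = xᵢ^p/S_p. Then the Shannon entropy H(w) = −Σᵢ wᵢ·ln wᵢ (with the convention 0·ln 0 = 0) satisfies 0 ≤ H(w) ≤ −(p/(p−1))·ln ‖x‖_p. -/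
open Finset

/-- Termwise form of Gibbs' inequality. -/
lemma mul_log_sub_mul_log_le {w x : ℝ} (hw : 0 < w) (hx : 0 < x) :
    w * Real.log x - w * Real.log w ≤ x - w := by
  have h := Real.log_le_sub_one_of_pos (div_pos hx hw)
  rw [Real.log_div hx.ne' hw.ne'] at h
  calc w * Real.log x - w * Real.log w = w * (Real.log x - Real.log w) := by ring
    _ ≤ w * (x / w - 1) := by gcongr
    _ = x - w := by field_simp

/-- for nonzero `x ∈ Δₙ`, with `S_p = ∑ xᵢ^p` and `wᵢ = xᵢ^p/S_p`,
the Shannon entropy `H(w) = -∑ wᵢ·ln wᵢ` satisfies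
`0 ≤ H(w) ≤ -(p/(p-1))·ln ‖x‖_p`. (Note `Real.log 0 = 0`, so the convention
`0·ln 0 = 0` is automatic.) -/
theorem stmt_12 (n : ℕ) (hn : 1 ≤ n) (p : ℝ) (hp : 2 ≤ p)
    (x : Fin n → ℝ) (hx : ∀ i, 0 ≤ x i) (hsum : ∑ i, x i = 1) (hx0 : x ≠ 0) :
    0 ≤ -∑ i, (x i ^ p / ∑ j, x j ^ p) * Real.log (x i ^ p / ∑ j, x j ^ p) ∧
    -∑ i, (x i ^ p / ∑ j, x j ^ p) * Real.log (x i ^ p / ∑ j, x j ^ p) ≤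
      -(p / (p - 1)) * Real.log ((∑ i, x i ^ p) ^ (1/p)) := by
  have hp0 : 0 < p := by linarith
  have hnonneg : ∀ i, 0 ≤ x i ^ p := fun i => Real.rpow_nonneg (hx i) p
  have hS : 0 < ∑ j, x j ^ p := by
    obtain ⟨i, hi⟩ := Function.ne_iff.mp hx0
    exact Finset.sum_pos' (fun j _ => hnonneg j)
      ⟨i, Finset.mem_univ i, Real.rpow_pos_of_pos (lt_of_le_of_ne (hx i) (Ne.symm hi)) p⟩
  set S := ∑ j, x j ^ p with hSdef
  have hw_sum : ∑ i, x i ^ p / S = 1 := by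
    rw [← Finset.sum_div, ← hSdef, div_self hS.ne']
  refine ⟨?_, ?_⟩
  · rw [neg_nonneg]
    refine Finset.sum_nonpos fun i _ => ?_
    have hle : x i ^ p / S ≤ 1 :=
      (div_le_one hS).mpr (Finset.single_le_sum (fun j _ => hnonneg j) (Finset.mem_univ i))
    have h0 : 0 ≤ x i ^ p / S := div_nonneg (hnonneg i) hS.le
    exact mul_nonpos_of_nonneg_of_nonpos h0 (Real.log_nonpos h0 hle)
  · have hterm : ∀ i, x i ^ p / S * Real.log S - (p - 1) * (x i ^ p / S * Real.log (x i ^ p / S))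
        ≤ p * (x i - x i ^ p / S) := by
      intro i
      rcases (hx i).eq_or_lt with h | h
      · simp [← h, Real.zero_rpow hp0.ne']
      · have hxp := Real.rpow_pos_of_pos h p
        have hlog : Real.log (x i ^ p / S) = p * Real.log (x i) - Real.log S := by
          rw [Real.log_div hxp.ne' hS.ne', Real.log_rpow h]
        have hg := mul_le_mul_of_nonneg_left
          (mul_log_sub_mul_log_le (div_pos hxp hS) h) hp0.le
        rw [hlog] at hg ⊢
        linarith
    have hle := Finset.sum_le_sum fun i (_ : i ∈ Finset.univ) => hterm i
    rw [Finset.sum_sub_distrib, ← Finset.sum_mul, ← Finset.mul_sum, ← Finset.mul_sum,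
      Finset.sum_sub_distrib, hw_sum, hsum] at hle
    have hp1 : 0 < p - 1 := by linarith
    have hrhs : -(p / (p - 1)) * Real.log (S ^ (1 / p)) = -Real.log S / (p - 1) := by
      rw [Real.log_rpow hS]
      field_simp
    rw [hrhs, le_div_iff₀ hp1]
    linarith
end

section
/- Let n ≥ 1 be an integer, p ≥ 2 a real number, ε ∈ [0,1], and let x ∈ 𝒴(ε,p). Then ‖x‖₂ ≤ ((D_p + 1)/√n)·(1/(1 + ε·D_p)). -/
open Finset

/-- Power mean inequality between the `ℓ²` and `ℓᵖ` norms, for `p ≥ 2`. -/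
theorem sum_sq_rpow_half_le {ι : Type*} (s : Finset ι) {p : ℝ} (hp : 2 ≤ p) (x : ι → ℝ)
    (hx : ∀ i ∈ s, 0 ≤ x i) :
    (∑ i ∈ s, x i ^ 2) ^ ((1:ℝ)/2) ≤
      (#s : ℝ) ^ (1/2 - 1/p) * (∑ i ∈ s, x i ^ p) ^ (1/p) := by
  have hp0 : 0 < p := by linarith
  have hS : 0 ≤ ∑ i ∈ s, x i ^ 2 := sum_nonneg fun i _ => sq_nonneg _
  have hP : 0 ≤ ∑ i ∈ s, x i ^ p := sum_nonneg fun i hi => Real.rpow_nonneg (hx i hi) _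
  have key := Real.rpow_sum_le_const_mul_sum_rpow_of_nonneg s (f := fun i => x i ^ 2)
    (p := p / 2) (by linarith) (fun i _ => sq_nonneg _)
  have hpow : ∑ i ∈ s, (x i ^ 2) ^ (p / 2) = ∑ i ∈ s, x i ^ p := by
    refine sum_congr rfl fun i hi => ?_
    rw [← Real.rpow_natCast, ← Real.rpow_mul (hx i hi)]
    congr 1
    push_cast
    ring
  rw [hpow] at key
  have hroot := Real.rpow_le_rpow (Real.rpow_nonneg hS _) key (by positivity : 0 ≤ 1 / p)
  rw [Real.mul_rpow (by positivity) hP, ← Real.rpow_mul hS, ← Real.rpow_mul (by positivity)]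
    at hroot
  have e₁ : p / 2 * (1 / p) = 1 / 2 := by field_simp
  have e₂ : (p / 2 - 1) * (1 / p) = 1 / 2 - 1 / p := by field_simp
  rwa [e₁, e₂] at hroot

/-- for `x ∈ 𝒴(ε,p)`,
`‖x‖₂ ≤ ((D_p+1)/√n)·(1/(1+ε·D_p))`. -/
theorem stmt_19 (n : ℕ) (hn : 1 ≤ n) (p : ℝ) (hp : 2 ≤ p)
    (ε : ℝ) (hε : ε ∈ Set.Icc (0:ℝ) 1)
    (x : Fin n → ℝ) (hx : ∀ i, 0 ≤ x i) (hsum : ∑ i, x i = 1)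
    (hfair : (1 + ε * ((n : ℝ) ^ (1 - 1/p) - 1)) * (∑ i, x i ^ p) ^ (1/p) ≤ 1) :
    (∑ i, x i ^ 2) ^ ((1:ℝ)/2) ≤
      ((((n : ℝ) ^ (1 - 1/p) - 1) + 1) / Real.sqrt n) *
        (1 / (1 + ε * ((n : ℝ) ^ (1 - 1/p) - 1))) := by
  have hn1 : (1:ℝ) ≤ n := by exact_mod_cast hn
  have hn0 : (0:ℝ) < n := by linarith
  have hp1 : 1 / p ≤ 1 := by
    rw [div_le_one (by linarith)]
    linarith
  have hD : 1 ≤ (n : ℝ) ^ (1 - 1/p) := Real.one_le_rpow hn1 (by linarith)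
  have hc : 0 < 1 + ε * ((n : ℝ) ^ (1 - 1/p) - 1) := by
    have := mul_nonneg hε.1 (sub_nonneg.2 hD)
    linarith
  have hcoef : (((n : ℝ) ^ (1 - 1/p) - 1) + 1) / Real.sqrt n = (n : ℝ) ^ (1/2 - 1/p) := by
    rw [sub_add_cancel, Real.sqrt_eq_rpow, ← Real.rpow_sub hn0]
    congr 1
    ring
  have hmean := sum_sq_rpow_half_le univ hp x fun i _ => hx i
  rw [card_univ, Fintype.card_fin] at hmean
  rw [hcoef]
  refine hmean.trans (mul_le_mul_of_nonneg_left ?_ (by positivity))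
  rwa [le_div_iff₀' hc]
end
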